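/- In the matrix Charlier setting with the specific parameters, let (P_n^{(λ)}) be the monic orthogonal sequence of W^{(λ)}. Let J = diag(1,2,…,N) and, for an integer ν ≥ 1, set 𝒜_ν = (N+ν−J)^{−1}·J·A^* (note N+ν−J = diag(N+ν−1,…,ν) is invertible and 𝒜_ν is strictly upper triangular). Then for every λ ∈ ℕ₀ and every n ≥ 1, the value of the monic matrix Charlier polynomial at zero is P_n^{(λ)}(0) = (−a)^n·L_0^{−1}·(I+A)^{n+λ}·(I+𝒜_{n+λ})^n·(I+A)^{−λ}·L_0. -/

import Mathlib

open scoped BigOperators ComplexOrder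
open Matrix Polynomial

noncomputable section

/-- The space of `N × N` complex matrices, with rows and columns indexed by `Fin N`
(the index `j : Fin N` corresponds to the row/column `j+1 ∈ {1,…,N}` of the paper). -/
abbrev Mat (N : ℕ) := Matrix (Fin N) (Fin N) ℂ

/-- Evaluation of a matrix polynomial at a (scalar) complex number. -/
def matEval {N : ℕ} (P : Polynomial (Mat N)) (z : ℂ) : Mat N :=
  P.eval (z • (1 : Mat N))

/-- The scalar Charlier polynomial
`c_n^{(a)}(x) = ∑_{k=0}^n ((-n)_k (-x)_k / k!) (-1/a)^k`. -/
def charlier (a : ℂ) (n : ℕ) (x : ℂ) : ℂ :=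
  ∑ k ∈ Finset.range (n + 1),
    (ascPochhammer ℂ k).eval (-(n : ℂ)) * (ascPochhammer ℂ k).eval (-x)
      / (k.factorial : ℂ) * (-(1 / a)) ^ k

/-- The nilpotent matrix `A` with `A_{j+1,j} = μ_{j+1}/μ_j` (paper indices `1,…,N`). -/
def Amat (N : ℕ) (μ : ℕ → ℝ) : Mat N :=
  Matrix.of fun j k : Fin N =>
    if (j : ℕ) = (k : ℕ) + 1 then ((μ ((j : ℕ) + 1) / μ ((k : ℕ) + 1) : ℝ) : ℂ) else 0

/-- The diagonal matrix `T = diag(δ_1,…,δ_N)`. -/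
def Tmat (N : ℕ) (δ : ℕ → ℝ) : Mat N :=
  Matrix.diagonal fun k : Fin N => ((δ ((k : ℕ) + 1) : ℝ) : ℂ)

/-- The matrix Charlier weight
`W^{(λ)}(x) = (a^x/x!) (I+A)^{x+λ} T^{(λ)} (I+A^*)^{x+λ}`. -/
def Wch (N : ℕ) (a : ℝ) (μ δ : ℕ → ℝ) (lam x : ℕ) : Mat N :=
  ((a ^ x / x.factorial : ℝ) : ℂ) •
    ((1 + Amat N μ) ^ (x + lam) * Tmat N δ * (1 + (Amat N μ)ᴴ) ^ (x + lam))

/-- The unipotent lower triangular matrix `L(x)` with entries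
`L(x)_{j,k} = (μ_j/μ_k)(-a)^{j-k} c_{j-k}^{(a)}(x)/(j-k)!` for `j ≥ k`. -/
def Lmat (N : ℕ) (a : ℝ) (μ : ℕ → ℝ) (z : ℂ) : Mat N :=
  Matrix.of fun j k : Fin N =>
    if (k : ℕ) ≤ (j : ℕ) then
      ((μ ((j : ℕ) + 1) / μ ((k : ℕ) + 1) : ℝ) : ℂ) * (-(a : ℂ)) ^ ((j : ℕ) - (k : ℕ))
        * charlier (a : ℂ) ((j : ℕ) - (k : ℕ)) z / ((((j : ℕ) - (k : ℕ)).factorial) : ℂ)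
    else 0

/-- Matrix-valued inner product for a weight supported on `ℕ₀`. -/
def innerN {N : ℕ} (W : ℕ → Mat N) (P Q : Polynomial (Mat N)) : Mat N :=
  ∑' x : ℕ, matEval P x * W x * (matEval Q x)ᴴ

/-- `P` is the monic orthogonal sequence of the weight `W` supported on `ℕ₀`. -/
structure IsMOSN {N : ℕ} (W : ℕ → Mat N) (P : ℕ → Polynomial (Mat N)) : Prop where
  monic : ∀ n, (P n).Monic
  deg : ∀ n, (P n).natDegree = n
  orth : ∀ m n, m ≠ n → innerN W (P m) (P n) = 0

/-- The diagonal matrix `J = diag(1,2,…,N)`. -/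
def Jdiag (N : ℕ) : Mat N := Matrix.diagonal fun j : Fin N => ((j : ℕ) + 1 : ℂ)

/-- The specific parameters `μ_j = a^{-j/2}/√((N-j)!)`. -/
def μch (N : ℕ) (a : ℝ) (j : ℕ) : ℝ :=
  (Real.sqrt a ^ j * Real.sqrt ((N - j).factorial))⁻¹

/-- The specific parameters `δ_k^{(λ)} = (a/2)^λ (λ+k-1)!/(k-1)!`. -/
def δch (a : ℝ) (lam k : ℕ) : ℝ :=
  (a / 2) ^ lam * ((lam + k - 1).factorial : ℝ) / ((k - 1).factorial : ℝ)

/-- The diagonal matrix `D_n^{(λ)}` with entries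
`(-1)^j e^a n! a^n (a/2)^λ ((λ+N-j)!/(j-1)!) (-N-λ-n)_j/(λ+n+1)_{N-j+1}`
(paper index `j ∈ {1,…,N}`). -/
def Dch (N : ℕ) (a : ℝ) (n lam : ℕ) : Mat N :=
  Matrix.diagonal fun j : Fin N =>
    (-1 : ℂ) ^ ((j : ℕ) + 1) * Complex.exp (a : ℂ) * (n.factorial : ℂ) * (a : ℂ) ^ n
      * ((a : ℂ) / 2) ^ lam * (((lam + (N - ((j : ℕ) + 1))).factorial) : ℂ)
      / (((j : ℕ).factorial) : ℂ)
      * (ascPochhammer ℂ ((j : ℕ) + 1)).eval (-((N : ℂ) + (lam : ℂ) + (n : ℂ)))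
      / (ascPochhammer ℂ (N - (j : ℕ))).eval ((lam : ℂ) + (n : ℂ) + 1)

/-- The matrix `𝒜_ν = (N+ν-J)⁻¹ J A^*`. -/
def Acal (N : ℕ) (a : ℝ) (ν : ℕ) : Mat N :=
  (((N : ℂ) + (ν : ℂ)) • (1 : Mat N) - Jdiag N)⁻¹ * (Jdiag N * (Amat N (μch N a))ᴴ)

section Algebra

variable {R : Type*} [Ring R] [Algebra ℂ R]

/-- The space of polynomial functions `ℂ → R` of degree less than `d`. -/
def polyLT (R : Type*) [Ring R] [Algebra ℂ R] (d : ℕ) : Submodule ℂ (ℂ → R) :=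
  Submodule.span ℂ {f | ∃ k < d, ∃ c : R, f = fun x => x ^ k • c}

/-- `f` is a polynomial function of degree at most `d` whose coefficient of `x ^ d` is `c`. -/
def HasLead (d : ℕ) (c : R) (f : ℂ → R) : Prop :=
  (fun x => f x - x ^ d • c) ∈ polyLT R d

lemma monomial_mem_polyLT {k d : ℕ} (h : k < d) (c : R) :
    (fun x : ℂ => x ^ k • c) ∈ polyLT R d :=
  Submodule.subset_span ⟨k, h, c, rfl⟩

lemma polyLT_mono {d e : ℕ} (h : d ≤ e) : polyLT R d ≤ polyLT R e :=
  Submodule.span_mono fun _ ⟨k, hk, c, hf⟩ => ⟨k, hk.trans_le h, c, hf⟩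

lemma map_mem_polyLT {d e : ℕ} (φ : (ℂ → R) →ₗ[ℂ] (ℂ → R))
    (h : ∀ k < d, ∀ c : R, φ (fun x => x ^ k • c) ∈ polyLT R e) {f : ℂ → R}
    (hf : f ∈ polyLT R d) : φ f ∈ polyLT R e := by
  have : polyLT R d ≤ (polyLT R e).comap φ := by
    refine Submodule.span_le.2 ?_
    rintro _ ⟨k, hk, c, rfl⟩
    exact h k hk c
  exact this hf

lemma const_mul_mem_polyLT {d : ℕ} {f : ℂ → R} (c : R) (hf : f ∈ polyLT R d) :
    (fun x => c * f x) ∈ polyLT R d := by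
  refine map_mem_polyLT ⟨⟨fun f x => c * f x, ?_⟩, ?_⟩ ?_ hf
  · intro f g; ext x; simp [mul_add]
  · intro r f; ext x; simp
  · intro k hk b
    simpa using monomial_mem_polyLT hk (c * b)

lemma mul_const_mem_polyLT {d : ℕ} {f : ℂ → R} (c : R) (hf : f ∈ polyLT R d) :
    (fun x => f x * c) ∈ polyLT R d := by
  refine map_mem_polyLT ⟨⟨fun f x => f x * c, ?_⟩, ?_⟩ ?_ hf
  · intro f g; ext x; simp [add_mul]
  · intro r f; ext x; simp
  · intro k hk b
    simpa using monomial_mem_polyLT hk (b * c)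

lemma X_smul_mem_polyLT {d : ℕ} {f : ℂ → R} (hf : f ∈ polyLT R d) :
    (fun x => x • f x) ∈ polyLT R (d + 1) := by
  refine map_mem_polyLT ⟨⟨fun f x => x • f x, ?_⟩, ?_⟩ ?_ hf
  · intro f g; ext x; simp
  · intro r f; ext x; exact smul_comm _ _ _
  · intro k hk b
    simpa [smul_smul, pow_succ'] using monomial_mem_polyLT (Nat.succ_lt_succ hk) b

lemma hasLead_monomial (d : ℕ) (c : R) : HasLead d c (fun x => x ^ d • c) := by
  simp only [HasLead, sub_self]
  exact zero_mem _

lemma HasLead.add {d : ℕ} {c c' : R} {f g : ℂ → R} (hf : HasLead d c f) (hg : HasLead d c' g) :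
    HasLead d (c + c') (fun x => f x + g x) := by
  unfold HasLead at *
  convert add_mem hf hg using 1
  ext x; simp; abel

lemma HasLead.sub {d : ℕ} {c c' : R} {f g : ℂ → R} (hf : HasLead d c f) (hg : HasLead d c' g) :
    HasLead d (c - c') (fun x => f x - g x) := by
  unfold HasLead at *
  convert sub_mem hf hg using 1
  ext x; simp [smul_sub]; abel

lemma HasLead.mul_const {d : ℕ} {c : R} {f : ℂ → R} (hf : HasLead d c f) (b : R) :
    HasLead d (c * b) (fun x => f x * b) := by
  unfold HasLead at *
  convert mul_const_mem_polyLT b hf using 1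
  ext x; simp [sub_mul]

lemma HasLead.const_mul {d : ℕ} {c : R} {f : ℂ → R} (hf : HasLead d c f) (b : R) :
    HasLead d (b * c) (fun x => b * f x) := by
  unfold HasLead at *
  convert const_mul_mem_polyLT b hf using 1
  ext x; simp [mul_sub]

lemma HasLead.X_smul {d : ℕ} {c : R} {f : ℂ → R} (hf : HasLead d c f) :
    HasLead (d + 1) c (fun x => x • f x) := by
  unfold HasLead at *
  convert X_smul_mem_polyLT hf using 1
  ext x; simp [smul_sub, smul_smul, pow_succ']

lemma hasLead_zero_iff {d : ℕ} {f : ℂ → R} : HasLead d 0 f ↔ f ∈ polyLT R d := by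
  simp [HasLead]

lemma HasLead.mem_polyLT {d : ℕ} {c : R} {f : ℂ → R} (hf : HasLead d c f) :
    f ∈ polyLT R (d + 1) := by
  convert add_mem (polyLT_mono d.le_succ hf) (monomial_mem_polyLT d.lt_succ_self c) using 1
  ext x; simp

lemma exists_hasLead_of_mem_polyLT {d : ℕ} {f : ℂ → R} (hf : f ∈ polyLT R (d + 1)) :
    ∃ c, HasLead d c f := by
  refine Submodule.span_induction (p := fun f _ => ∃ c, HasLead d c f) ?_ ?_ ?_ ?_ hf
  · rintro _ ⟨k, hk, c, rfl⟩
    rcases (Nat.lt_succ_iff_lt_or_eq.1 hk) with h | rfl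
    · exact ⟨0, hasLead_zero_iff.2 (monomial_mem_polyLT h c)⟩
    · exact ⟨c, hasLead_monomial _ c⟩
  · exact ⟨0, hasLead_zero_iff.2 (zero_mem _)⟩
  · rintro f g - - ⟨c, hc⟩ ⟨c', hc'⟩
    exact ⟨c + c', hc.add hc'⟩
  · rintro r f - ⟨c, hc⟩
    refine ⟨r • c, ?_⟩
    convert hc.const_mul (algebraMap ℂ R r) using 1
    · rw [Algebra.smul_def]
    · ext x; rw [Pi.smul_apply, Algebra.smul_def]

lemma hasLead_shift (t : ℂ) (k : ℕ) (c : R) : HasLead k c (fun x : ℂ => (x + t) ^ k • c) := by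
  induction k with
  | zero => simpa using hasLead_monomial 0 c
  | succ k ih =>
    have h := ih.X_smul.add
      (hasLead_zero_iff.2 (((polyLT R (k + 1)).smul_mem t ih.mem_polyLT)))
    convert h using 1
    · simp
    · ext x; simp [pow_succ', smul_smul, add_mul, add_smul]

lemma difference_mem_polyLT {d : ℕ} {f : ℂ → R} (hf : f ∈ polyLT R (d + 1)) :
    (fun x => f (x + 1) - f x) ∈ polyLT R d := by
  refine map_mem_polyLT ⟨⟨fun f x => f (x + 1) - f x, ?_⟩, ?_⟩ ?_ hf
  · intro f g; ext x; simp; abel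
  · intro r f; ext x; simp [smul_sub]
  · intro k hk c
    exact polyLT_mono (Nat.lt_succ_iff.1 hk) (hasLead_shift 1 k c)

lemma hasLead_X_smul_backward_monomial (k : ℕ) (c : R) :
    HasLead k ((k : ℂ) • c) (fun x : ℂ => x • (x ^ k • c - (x - 1) ^ k • c)) := by
  induction k with
  | zero =>
    simp only [Nat.cast_zero, zero_smul, pow_zero, sub_self, smul_zero]
    exact hasLead_zero_iff.2 (zero_mem _)
  | succ k ih =>
    convert ih.X_smul.add (hasLead_shift (-1) k c).X_smul using 1
    · push_cast; module
    · ext x; simp only [← sub_eq_add_neg, pow_succ']; module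

lemma HasLead.X_smul_backward {d : ℕ} {c : R} {f : ℂ → R} (hf : HasLead d c f) :
    HasLead d ((d : ℂ) • c) (fun x : ℂ => x • (f x - f (x - 1))) := by
  have key : (fun x : ℂ => x • ((f x - x ^ d • c) - (f (x - 1) - (x - 1) ^ d • c)))
      ∈ polyLT R d := by
    refine map_mem_polyLT ⟨⟨fun f x => x • (f x - f (x - 1)), ?_⟩, ?_⟩ ?_ hf
    · intro f g; ext x; simp only [Pi.add_apply]; module
    · intro r f; ext x; simp only [Pi.smul_apply, RingHom.id_apply]; module
    · intro k hk c
      exact polyLT_mono hk (hasLead_X_smul_backward_monomial k c).mem_polyLT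
  convert (hasLead_zero_iff.2 key).add (hasLead_X_smul_backward_monomial d c) using 1
  · simp
  · ext x; module

/-- The left-hand side is `f x * M x - f (x - 1) * B x`, for `M - B` of degree one and `B` of degree
two without constant term. -/
lemma HasLead.backward_shift {d : ℕ} {f M B : ℂ → R} (hf : HasLead d 1 f) {K₀ K₁ B₁ B₂ : R}
    (hM : ∀ x, M x - B x = K₀ + x • K₁) (hB : ∀ x, B x = x • B₁ + x ^ 2 • B₂) :
    HasLead (d + 1) (K₁ + (d : ℂ) • B₂) (fun x => f x * M x - f (x - 1) * B x) := by
  have hd := hf.X_smul_backward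
  have h₀ := hasLead_zero_iff.2 (hf.mul_const K₀).mem_polyLT
  have h₁ := hasLead_zero_iff.2 (hd.mul_const B₁).mem_polyLT
  convert (h₀.add (hf.mul_const K₁).X_smul).add (h₁.add (hd.mul_const B₂).X_smul) using 1
  · simp
  · ext x
    have : f x * M x - f (x - 1) * B x = f x * (M x - B x) + (f x - f (x - 1)) * B x := by
      noncomm_ring
    rw [this, hM, hB]
    simp only [mul_add, mul_smul_comm, smul_mul_assoc, smul_smul, pow_two]

lemma pow_mul_eq_sub_smul_mul_pow {E J V : R} (h : E * J = (J - V) * E) (hV : E * V = V * E)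
    (s : ℕ) : E ^ s * J = (J - (s : ℂ) • V) * E ^ s := by
  induction s with
  | zero => simp
  | succ s ih =>
    rw [pow_succ', mul_assoc, ih, ← mul_assoc, ← mul_assoc]
    congr 1
    rw [mul_sub, h, mul_smul_comm, hV, ← smul_mul_assoc, ← sub_mul]
    congr 1
    push_cast; module

lemma pow_mul_eq_quadratic_mul_pow {A E H X U : R} {c : ℂ} (hX : E * X = X * E + c • H)
    (hH : H * E = E * H + (2 : ℂ) • A) (hEU : E * U = 1) (hUE : U * E = 1) (hA : U * A = A * U)
    (s : ℕ) : E ^ s * X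
      = (X + (s * c) • (U * H) - (s * (s + 1) * c) • (U * (A * U))) * E ^ s := by
  induction s with
  | zero => simp
  | succ s ih =>
    have h1 : E * (U * H) = H := by rw [← mul_assoc, hEU, one_mul]
    have h2 : E * (U * (A * U)) = A * U := by rw [← mul_assoc, hEU, one_mul]
    have h3 : U * H * E = H + (2 : ℂ) • (A * U) := by
      rw [mul_assoc, hH, mul_add, ← mul_assoc, hUE, one_mul, mul_smul_comm, hA]
    have h4 : U * (A * U) * E = A * U := by
      rw [mul_assoc, mul_assoc, hUE, mul_one, hA]
    have key : E * (X + (s * c) • (U * H) - (s * (s + 1) * c) • (U * (A * U)))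
        = (X + ((s + 1 : ℕ) * c) • (U * H) - ((s + 1 : ℕ) * ((s + 1 : ℕ) + 1) * c) • (U * (A * U)))
          * E := by
      simp only [mul_add, mul_sub, add_mul, sub_mul, mul_smul_comm, smul_mul_assoc, h1, h2, h3,
        h4, hX]
      push_cast
      module
    rw [pow_succ', mul_assoc, ih, ← mul_assoc E, key, mul_assoc]

lemma commutator_pow_lowering {A H X : R} {c : ℂ} (hX : A * X = X * A + c • H)
    (hH : H * A = A * H + (2 : ℂ) • A) (k : ℕ) :
    X * A ^ (k + 1) = A ^ (k + 1) * X
      - (((k : ℂ) + 1) * c) • (A ^ k * H) - ((k : ℂ) * (k + 1) * c) • A ^ k := by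
  have hX' : X * A = A * X - c • H := by rw [hX]; abel
  induction k with
  | zero => simpa using hX'
  | succ k ih =>
    rw [pow_succ A (k + 1), ← mul_assoc, ih]
    simp only [sub_mul, smul_mul_assoc, mul_assoc, hX', hH, mul_sub, mul_add, mul_smul_comm]
    simp only [← mul_assoc, ← pow_succ]
    push_cast
    module

lemma mul_pow_of_commutator {A J : R} (hJ : J * A = A * J + A) (k : ℕ) :
    J * A ^ k = A ^ k * J + (k : ℂ) • A ^ k := by
  induction k with
  | zero => simp
  | succ k ih =>
    rw [pow_succ, ← mul_assoc, ih, add_mul, mul_assoc, hJ]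
    simp only [mul_add, smul_mul_assoc, ← mul_assoc]
    push_cast
    module

lemma exp_term_succ (b : ℂ) (A : R) (k : ℕ) :
    ((k : ℂ) + 1) • ((b ^ (k + 1) / ((k + 1).factorial : ℂ)) • A ^ (k + 1))
      = b • (A * ((b ^ k / (k.factorial : ℂ)) • A ^ k)) := by
  have h1 : (k.factorial : ℂ) ≠ 0 := by exact_mod_cast k.factorial_ne_zero
  have h2 : (k : ℂ) + 1 ≠ 0 := by exact_mod_cast k.succ_ne_zero
  rw [mul_smul_comm, ← pow_succ', smul_smul, smul_smul, Nat.factorial_succ]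
  congr 1
  push_cast
  field_simp
  ring

lemma exp_sum_mul_raising {A J : R} (hJ : J * A = A * J + A) (b : ℂ) {n : ℕ} (hA : A ^ n = 0) :
    (∑ k ∈ Finset.range (n + 1), (b ^ k / (k.factorial : ℂ)) • A ^ k) * J
      = (J - b • A) * ∑ k ∈ Finset.range (n + 1), (b ^ k / (k.factorial : ℂ)) • A ^ k := by
  set e : ℕ → R := fun k => (b ^ k / (k.factorial : ℂ)) • A ^ k with he
  change (∑ k ∈ Finset.range (n + 1), e k) * J = (J - b • A) * ∑ k ∈ Finset.range (n + 1), e k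
  have hen : e n = 0 := by simp [he, hA]
  have h1 : ∀ k, J * e k = e k * J + (k : ℂ) • e k := fun k => by
    simp only [he, mul_smul_comm, mul_pow_of_commutator hJ, smul_mul_assoc, smul_add]
    rw [smul_comm]
  have h2 : ∑ k ∈ Finset.range (n + 1), (k : ℂ) • e k
      = b • (A * ∑ k ∈ Finset.range (n + 1), e k) := by
    rw [Finset.sum_range_succ', Finset.sum_range_succ, hen, add_zero, Finset.mul_sum,
      Finset.smul_sum]
    simp only [Nat.cast_zero, zero_smul, add_zero]
    exact Finset.sum_congr rfl fun k _ => by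
      push_cast; exact exp_term_succ b A k
  rw [sub_mul, smul_mul_assoc, ← h2, Finset.mul_sum, Finset.sum_mul, ← Finset.sum_sub_distrib]
  exact Finset.sum_congr rfl fun k _ => by rw [h1]; abel

lemma exp_sum_mul_lowering {A H X : R} {b c : ℂ} (hbc : b * c = -1)
    (hX : A * X = X * A + c • H) (hH : H * A = A * H + (2 : ℂ) • A) {n : ℕ} (hA : A ^ n = 0) :
    X * (∑ k ∈ Finset.range (n + 2), (b ^ k / (k.factorial : ℂ)) • A ^ k)
      = (∑ k ∈ Finset.range (n + 2), (b ^ k / (k.factorial : ℂ)) • A ^ k) * (X + H)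
        + b • (A * ∑ k ∈ Finset.range (n + 2), (b ^ k / (k.factorial : ℂ)) • A ^ k) := by
  set e : ℕ → R := fun k => (b ^ k / (k.factorial : ℂ)) • A ^ k with he
  change X * (∑ k ∈ Finset.range (n + 2), e k)
    = (∑ k ∈ Finset.range (n + 2), e k) * (X + H) + b • (A * ∑ k ∈ Finset.range (n + 2), e k)
  have hen : e n = 0 := by simp [he, hA]
  have hen' : e (n + 1) = 0 := by simp [he, pow_succ, hA]
  have h1 : ∀ k, X * e (k + 1) = e (k + 1) * X + e k * H + (k : ℂ) • e k := fun k => by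
    have h1 : (k.factorial : ℂ) ≠ 0 := by exact_mod_cast k.factorial_ne_zero
    have h2 : (k : ℂ) + 1 ≠ 0 := by exact_mod_cast k.succ_ne_zero
    have h3 : b ^ (k + 1) / ((k + 1).factorial : ℂ) * (((k : ℂ) + 1) * c)
        = - (b ^ k / (k.factorial : ℂ)) := by
      rw [Nat.factorial_succ, pow_succ]
      push_cast
      field_simp
      linear_combination b ^ k * hbc
    simp only [he, mul_smul_comm, commutator_pow_lowering hX hH, smul_mul_assoc, smul_sub,
      smul_smul, h3]
    rw [show b ^ (k + 1) / ((k + 1).factorial : ℂ) * ((k : ℂ) * (k + 1) * c)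
      = k * (b ^ (k + 1) / ((k + 1).factorial : ℂ) * (((k : ℂ) + 1) * c)) by ring, h3]
    module
  have h2 : ∑ k ∈ Finset.range (n + 1), (k : ℂ) • e k
      = b • (A * ∑ k ∈ Finset.range (n + 1), e k) := by
    rw [Finset.sum_range_succ', Finset.sum_range_succ, hen, add_zero, Finset.mul_sum,
      Finset.smul_sum]
    simp only [Nat.cast_zero, zero_smul, add_zero]
    exact Finset.sum_congr rfl fun k _ => by
      push_cast; exact exp_term_succ b A k
  have h3 : ∑ k ∈ Finset.range (n + 2), e k = ∑ k ∈ Finset.range (n + 1), e k := by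
    rw [Finset.sum_range_succ _ (n + 1), hen', add_zero]
  have h4 : e 0 = 1 := by simp [he]
  rw [mul_add, add_assoc]
  nth_rewrite 3 4 [h3]
  rw [← h2, Finset.sum_range_succ', mul_add, add_mul, Finset.mul_sum, Finset.sum_mul,
    Finset.sum_mul, h4]
  simp only [h1, Finset.sum_add_distrib, mul_one, one_mul]
  abel

lemma pow_mul_eq_mul_pow_succ {Y X G : R} {n : ℂ} (hG : Y * G + n • G = Y + n • 1 + X)
    (hY : Y * G = G * Y + (G - 1)) (k : ℕ) (hn : n = k + 1) :
    G ^ k * (Y + 1 + X) = (Y + 1) * G ^ (k + 1) := by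
  have h : ∀ j : ℕ, G ^ j * Y * G = Y * G ^ (j + 1) - (j : ℂ) • (G ^ (j + 1) - G ^ j) := by
    intro j
    induction j with
    | zero => simp
    | succ j ih =>
      have : G * Y = Y * G - (G - 1) := by rw [hY]; abel
      have h' : G ^ (j + 1) * Y * G = G ^ j * (G * Y) * G := by rw [pow_succ]; noncomm_ring
      have h'' : G ^ j * (G - 1) * G = G ^ (j + 1 + 1) - G ^ (j + 1) := by
        simp only [pow_succ]; noncomm_ring
      rw [h', this, mul_sub, sub_mul, ← mul_assoc, ih, h'', sub_mul, smul_mul_assoc, sub_mul,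
        mul_assoc, ← pow_succ, ← pow_succ]
      push_cast; module
  have hX : Y + 1 + X = Y * G + n • G - (k : ℂ) • 1 := by rw [hG, hn]; module
  rw [hX, mul_sub, mul_add, ← mul_assoc, h, mul_smul_comm, mul_smul_comm, mul_one, ← pow_succ,
    add_mul, one_mul, hn]
  module

end Algebra

section Weights

variable {N : ℕ}

/-- `F` is entrywise bounded by a geometric sequence. -/
def GeomBounded (F : ℕ → Mat N) : Prop :=
  ∃ C r : ℝ, 0 ≤ C ∧ 0 ≤ r ∧ ∀ x i j, ‖F x i j‖ ≤ C * r ^ x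

lemma GeomBounded.add {F G : ℕ → Mat N} (hF : GeomBounded F) (hG : GeomBounded G) :
    GeomBounded fun x => F x + G x := by
  obtain ⟨C, r, hC, hr, h⟩ := hF
  obtain ⟨D, s, hD, hs, h'⟩ := hG
  refine ⟨C + D, max r s, add_nonneg hC hD, le_max_of_le_left hr, fun x i j => ?_⟩
  calc ‖(F x + G x) i j‖ ≤ ‖F x i j‖ + ‖G x i j‖ := norm_add_le _ _
    _ ≤ C * r ^ x + D * s ^ x := add_le_add (h x i j) (h' x i j)
    _ ≤ C * max r s ^ x + D * max r s ^ x := by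
      gcongr
      · exact le_max_left _ _
      · exact le_max_right _ _
    _ = _ := by ring

lemma GeomBounded.mul {F G : ℕ → Mat N} (hF : GeomBounded F) (hG : GeomBounded G) :
    GeomBounded fun x => F x * G x := by
  obtain ⟨C, r, hC, hr, h⟩ := hF
  obtain ⟨D, s, hD, hs, h'⟩ := hG
  refine ⟨N * (C * D), r * s, by positivity, by positivity, fun x i j => ?_⟩
  calc ‖(F x * G x) i j‖ ≤ ∑ l, ‖F x i l * G x l j‖ := by
        rw [Matrix.mul_apply]; exact norm_sum_le _ _
    _ ≤ ∑ _l : Fin N, (C * r ^ x) * (D * s ^ x) := by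
        refine Finset.sum_le_sum fun l _ => ?_
        rw [norm_mul]
        exact mul_le_mul (h x i l) (h' x l j) (norm_nonneg _) (by positivity)
    _ = _ := by simp [mul_pow]; ring

lemma GeomBounded.conjTranspose {F : ℕ → Mat N} (hF : GeomBounded F) :
    GeomBounded fun x => (F x)ᴴ := by
  obtain ⟨C, r, hC, hr, h⟩ := hF
  exact ⟨C, r, hC, hr, fun x i j => by simpa using h x j i⟩

lemma geomBounded_const (c : Mat N) : GeomBounded fun _ => c := by
  refine ⟨∑ i, ∑ j, ‖c i j‖, 1, by positivity, zero_le_one, fun x i j => ?_⟩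
  rw [one_pow, mul_one]
  exact (Finset.single_le_sum (f := fun j => ‖c i j‖) (fun _ _ => norm_nonneg _)
    (Finset.mem_univ j)).trans (Finset.single_le_sum (f := fun i => ∑ j, ‖c i j‖)
      (fun _ _ => by positivity) (Finset.mem_univ i))

lemma geomBounded_pow (c : Mat N) : GeomBounded fun x => c ^ x := by
  obtain ⟨C, r, hC, hr, h⟩ := geomBounded_const c
  refine ⟨1, N * C, zero_le_one, by positivity, fun x => ?_⟩
  induction x with
  | zero =>
    intro i j
    by_cases hij : i = j <;> simp [hij]
  | succ x ih =>
    intro i j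
    have h0 : ∀ i j, ‖c i j‖ ≤ C := by simpa using h 0
    calc ‖(c ^ (x + 1)) i j‖ ≤ ∑ l, ‖(c ^ x) i l * c l j‖ := by
          rw [pow_succ, Matrix.mul_apply]; exact norm_sum_le _ _
      _ ≤ ∑ _l : Fin N, (1 * (N * C) ^ x) * C := by
          refine Finset.sum_le_sum fun l _ => ?_
          rw [norm_mul]
          exact mul_le_mul (ih i l) (h0 l j) (norm_nonneg _) (by positivity)
      _ = _ := by simp [pow_succ]; ring

lemma geomBounded_of_mem_polyLT {d : ℕ} {f : ℂ → Mat N} (hf : f ∈ polyLT (Mat N) d) :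
    GeomBounded fun x : ℕ => f x := by
  refine Submodule.span_induction (p := fun f _ => GeomBounded fun x : ℕ => f x) ?_ ?_ ?_ ?_ hf
  · rintro _ ⟨k, hk, c, rfl⟩
    obtain ⟨C, r, hC, hr, h⟩ := geomBounded_const c
    have h0 : ∀ i j, ‖c i j‖ ≤ C := by simpa using h 0
    refine ⟨C, 2 ^ k, hC, by positivity, fun x i j => ?_⟩
    have hx : (x : ℝ) ≤ 2 ^ x := by exact_mod_cast Nat.lt_two_pow_self.le
    calc ‖((x : ℂ) ^ k • c) i j‖ = (x : ℝ) ^ k * ‖c i j‖ := by simp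
      _ ≤ (2 ^ x) ^ k * C := by gcongr; exact h0 i j
      _ = _ := by rw [← pow_mul, ← pow_mul, mul_comm x, mul_comm]
  · exact geomBounded_const 0
  · intro f g _ _ h h'
    exact h.add h'
  · rintro c f - h
    convert (geomBounded_const (c • (1 : Mat N))).mul h using 2
    simp

/-- Products of polynomial functions are summable against the weight `W`. -/
def HasMoments (W : ℕ → Mat N) : Prop :=
  ∀ d, ∀ f ∈ polyLT (Mat N) d, ∀ g ∈ polyLT (Mat N) d,
    Summable fun x : ℕ => f x * W x * (g x)ᴴ

lemma GeomBounded.summable {F : ℕ → Mat N} (hF : GeomBounded F) (a : ℝ) :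
    Summable fun x : ℕ => ((a ^ x / x.factorial : ℝ) : ℂ) • F x := by
  obtain ⟨C, r, hC, hr, h⟩ := hF
  refine Pi.summable.2 fun i => Pi.summable.2 fun j => ?_
  refine Summable.of_norm_bounded ((Real.summable_pow_div_factorial (|a| * r)).mul_left C)
    fun x => ?_
  calc ‖(((a ^ x / x.factorial : ℝ) : ℂ) • F x) i j‖ = |a| ^ x / x.factorial * ‖F x i j‖ := by
        simp
    _ ≤ |a| ^ x / x.factorial * (C * r ^ x) := by gcongr; exact h x i j
    _ = _ := by rw [mul_pow]; ring

lemma hasMoments_Wch (a : ℝ) (μ δ : ℕ → ℝ) (lam : ℕ) : HasMoments (Wch N a μ δ lam) := by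
  intro d f hf g hg
  have hpow : ∀ B : Mat N, GeomBounded fun x => B ^ (x + lam) := fun B => by
    simpa only [pow_add] using (geomBounded_pow B).mul (geomBounded_const (B ^ lam))
  have h := (((geomBounded_of_mem_polyLT hf).mul (((hpow (1 + Amat N μ)).mul
    (geomBounded_const (Tmat N δ))).mul (hpow (1 + (Amat N μ)ᴴ)))).mul
      (geomBounded_of_mem_polyLT hg).conjTranspose).summable a
  simpa only [Wch, mul_smul_comm, smul_mul_assoc] using h

lemma eq_zero_of_tsum_eq_zero {F : ℕ → Mat N} (hs : Summable F) (h : ∑' x, F x = 0)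
    (hF : ∀ x, (F x).PosSemidef) (x : ℕ) : F x = 0 := by
  have h0 : HasSum F 0 := h ▸ hs.hasSum
  have h1 : HasSum (fun x => (F x).trace) 0 := by
    simpa [Function.comp_def] using
      h0.map (Matrix.traceAddMonoidHom (Fin N) ℂ) (continuous_id.matrix_trace)
  have h2 := (hasSum_zero_iff_of_nonneg fun x => (hF x).trace_nonneg).1 h1
  exact (hF x).trace_eq_zero_iff.1 (congrFun h2 x)

lemma hasLead_matEval {P : Polynomial (Mat N)} (hP : P.Monic) :
    HasLead P.natDegree 1 (matEval P) := by
  have h : matEval P = fun z => ∑ k ∈ Finset.range (P.natDegree + 1), z ^ k • P.coeff k := by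
    ext1 z
    rw [matEval, Polynomial.eval_eq_sum_range]
    simp [_root_.smul_pow]
  rw [HasLead, h]
  have : (fun z : ℂ => ∑ k ∈ Finset.range (P.natDegree + 1), z ^ k • P.coeff k
      - z ^ P.natDegree • (1 : Mat N))
      = ∑ k ∈ Finset.range P.natDegree, fun z : ℂ => z ^ k • P.coeff k := by
    ext1 z
    rw [Finset.sum_range_succ, hP.coeff_natDegree, add_sub_cancel_right, Finset.sum_apply]
  convert Submodule.sum_mem (polyLT (Mat N) P.natDegree)
    fun k hk => monomial_mem_polyLT (Finset.mem_range.1 hk) (P.coeff k)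

lemma IsMOSN.hasLead {W : ℕ → Mat N} {P : ℕ → Polynomial (Mat N)} (hP : IsMOSN W P) (n : ℕ) :
    HasLead n 1 (matEval (P n)) := by
  simpa [hP.deg n] using hasLead_matEval (hP.monic n)

lemma IsMOSN.tsum_eq_zero {W : ℕ → Mat N} {P : ℕ → Polynomial (Mat N)} (hP : IsMOSN W P)
    (hW : HasMoments W) {n d : ℕ} (hd : d ≤ n) {g : ℂ → Mat N} (hg : g ∈ polyLT (Mat N) d) :
    ∑' x : ℕ, matEval (P n) x * W x * (g x)ᴴ = 0 := by
  induction d generalizing g with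
  | zero =>
    have : g = 0 := by simpa [polyLT] using hg
    simp [this]
  | succ d ih =>
    obtain ⟨c, hc⟩ := exists_hasLead_of_mem_polyLT hg
    have hPd := (hP.hasLead d).const_mul c
    have hr : (fun x => g x - c * matEval (P d) x) ∈ polyLT (Mat N) d := by
      simpa using hasLead_zero_iff.1 (by simpa using hc.sub hPd)
    have hPn := (hP.hasLead n).mem_polyLT
    have hdn : d + 1 ≤ n + 1 := by omega
    have h1 := hW (n + 1) _ hPn _ (polyLT_mono (d.le_succ.trans hdn) hr)
    have h2 := hW (n + 1) _ hPn _ (polyLT_mono hdn (hP.hasLead d).mem_polyLT)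
    have h3 := hP.orth n d (by omega)
    rw [innerN] at h3
    calc ∑' x : ℕ, matEval (P n) x * W x * (g x)ᴴ
        = ∑' x : ℕ, (matEval (P n) x * W x * (g x - c * matEval (P d) x)ᴴ
          + matEval (P n) x * W x * (matEval (P d) x)ᴴ * cᴴ) := by
          refine tsum_congr fun x => ?_
          rw [Matrix.conjTranspose_sub, Matrix.conjTranspose_mul]
          noncomm_ring
      _ = 0 := by
          rw [h1.tsum_add (h2.mul_right _), ih (by omega) hr, h2.tsum_mul_right, h3]
          simp

/-- Evaluation at zero of the backward shift relation between the monic orthogonal sequences of two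
weights related by a Pearson equation. -/
lemma IsMOSN.lead_mul_eval_zero {W W' : ℕ → Mat N} {P P' : ℕ → Polynomial (Mat N)}
    (hP : IsMOSN W P) (hP' : IsMOSN W' P') (hW : HasMoments W) (hW' : HasMoments W')
    (hpos : ∀ x, (W x).PosSemidef) (hpos0 : ∃ Y, IsUnit Y ∧ W 0 = Y * Yᴴ)
    {M B : ℂ → Mat N} {K₀ K₁ B₁ B₂ : Mat N} (hM : ∀ x, M x - B x = K₀ + x • K₁)
    (hB : ∀ x, B x = x • B₁ + x ^ 2 • B₂) (hMW : ∀ x : ℕ, M x * W x = W' x)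
    (hBW : ∀ x : ℕ, B (x + 1) * W (x + 1) = W' x) (m : ℕ) :
    (K₁ + (m : ℂ) • B₂) * matEval (P (m + 1)) 0 = matEval (P' m) 0 * M 0 := by
  set K := K₁ + (m : ℂ) • B₂
  set p := matEval (P' m)
  set R : ℂ → Mat N := fun x => p x * M x - p (x - 1) * B x with hR
  have hB0 : B 0 = 0 := by simp [hB]
  have hRlead : HasLead (m + 1) K R := (hP'.hasLead m).backward_shift hM hB
  have hRorth : ∀ g ∈ polyLT (Mat N) (m + 1), ∑' x : ℕ, R x * W x * (g x)ᴴ = 0 := by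
    intro g hg
    have hp := (hP'.hasLead m).mem_polyLT
    have hdiff := difference_mem_polyLT hg
    have hg1 : (fun x => g (x + 1)) ∈ polyLT (Mat N) (m + 1) := by
      simpa [Pi.add_def] using add_mem (polyLT_mono m.le_succ hdiff) hg
    have s1 := hW' _ _ hp _ hg
    have s2 := hW' _ _ hp _ hg1
    have s3 := hW _ _ hRlead.mem_polyLT _ (polyLT_mono (Nat.le_succ _) hg)
    have s4 := (summable_nat_add_iff 1).2 s1
    have h0 : R 0 * W 0 * (g 0)ᴴ = p 0 * W' 0 * (g 0)ᴴ := by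
      have := hMW 0
      rw [Nat.cast_zero] at this
      simp only [hR, hB0, mul_zero, sub_zero]
      rw [mul_assoc (p 0), this]
    have h1 : ∀ x : ℕ, R (x + 1 : ℕ) * W (x + 1) * (g (x + 1 : ℕ))ᴴ
        = p (x + 1 : ℕ) * W' (x + 1) * (g (x + 1 : ℕ))ᴴ - p x * W' x * (g (x + 1))ᴴ := by
      intro x
      have e1 := hMW (x + 1)
      have e2 := hBW x
      push_cast at e1 e2 ⊢
      simp only [hR, sub_mul, mul_assoc (p _), add_sub_cancel_right, e1, e2]
    have h2 := hP'.tsum_eq_zero hW' le_rfl hdiff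
    have h3 : ∑' x : ℕ, p x * W' x * (g x)ᴴ = ∑' x : ℕ, p x * W' x * (g (x + 1))ᴴ := by
      rw [← sub_eq_zero, ← s1.tsum_sub s2, ← neg_eq_zero, ← tsum_neg, ← h2]
      refine tsum_congr fun x => ?_
      rw [Matrix.conjTranspose_sub, mul_sub, neg_sub]
    rw [s3.tsum_eq_zero_add]
    simp only [h1]
    rw [s4.tsum_sub s2, Nat.cast_zero, h0, ← h3, s1.tsum_eq_zero_add, Nat.cast_zero]
    exact (add_sub_assoc _ _ _).symm.trans (sub_self _)
  set D : ℂ → Mat N := fun x => K * matEval (P (m + 1)) x - R x with hD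
  have hDmem : D ∈ polyLT (Mat N) (m + 1) := by
    simpa using hasLead_zero_iff.1
      (by simpa using ((hP.hasLead (m + 1)).const_mul K).sub hRlead)
  have s1 := hW (m + 2) _ (hP.hasLead (m + 1)).mem_polyLT _ (polyLT_mono (Nat.le_succ _) hDmem)
  have s2 := hW (m + 2) _ hRlead.mem_polyLT _ (polyLT_mono (Nat.le_succ _) hDmem)
  have hDD : ∑' x : ℕ, D x * W x * (D x)ᴴ = 0 := by
    have : ∀ x : ℕ, D x * W x * (D x)ᴴ
        = K * (matEval (P (m + 1)) x * W x * (D x)ᴴ) - R x * W x * (D x)ᴴ := fun x => by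
      rw [show D x * W x * (D x)ᴴ
        = (K * matEval (P (m + 1)) x - R x) * W x * (D x)ᴴ from rfl]
      noncomm_ring
    simp only [this]
    rw [(s1.mul_left K).tsum_sub s2, s1.tsum_mul_left, hP.tsum_eq_zero hW le_rfl hDmem,
      hRorth D hDmem]
    simp
  have hD0 := eq_zero_of_tsum_eq_zero (hW _ _ hDmem _ hDmem) hDD
    (fun x => (hpos x).mul_mul_conjTranspose_same _) 0
  obtain ⟨Y, hY, hYW⟩ := hpos0
  have : D 0 * Y = 0 := by
    rw [← Matrix.self_mul_conjTranspose_eq_zero, ← hD0, hYW, Matrix.conjTranspose_mul]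
    simp only [Nat.cast_zero, mul_assoc]
  have hD' : D 0 = 0 := (hY.mul_left_eq_zero).1 this
  simpa [hD, hR, hB0, sub_eq_zero] using hD'

end Weights

section Parameters

variable {N : ℕ} {a : ℝ}

lemma μch_div_sq (ha : 0 < a) {k : ℕ} (hk : k + 1 < N) :
    (μch N a (k + 2) / μch N a (k + 1)) ^ 2 = (N - (k + 1)) / a := by
  obtain ⟨d, rfl⟩ : ∃ d, N = k + 2 + d := ⟨N - (k + 2), by omega⟩
  have h1 : k + 2 + d - (k + 1) = d + 1 := by omega
  have h2 : k + 2 + d - (k + 2) = d := by omega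
  have hd : (d.factorial : ℝ) ≠ 0 := by exact_mod_cast d.factorial_ne_zero
  rw [μch, μch, h1, h2, inv_div_inv, div_pow, mul_pow, mul_pow, Real.sq_sqrt (by positivity),
    Real.sq_sqrt (by positivity), ← pow_mul, ← pow_mul, mul_comm _ 2, mul_comm _ 2, pow_mul,
    pow_mul, Real.sq_sqrt ha.le, Nat.factorial_succ]
  push_cast
  field_simp
  ring

lemma Amat_apply_succ (μ : ℕ → ℝ) {l : ℕ} (hl : l + 1 < N) :
    Amat N μ ⟨l + 1, hl⟩ ⟨l, by omega⟩ = ((μ (l + 2) / μ (l + 1) : ℝ) : ℂ) := by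
  simp [Amat]

lemma Amat_apply_of_ne (μ : ℕ → ℝ) {j k : Fin N} (h : (j : ℕ) ≠ k + 1) : Amat N μ j k = 0 := by
  simp [Amat, h]

lemma Amat_mul_diagonal_mul_conjTranspose (ha : 0 < a) (d : ℕ → ℂ) :
    Amat N (μch N a) * (Matrix.diagonal (fun j : Fin N => d j) * (Amat N (μch N a))ᴴ)
      = Matrix.diagonal fun j : Fin N =>
          if (j : ℕ) = 0 then 0 else d (j - 1) * ((N - (j : ℕ)) / a) := by
  ext ⟨j, hj⟩ ⟨k, hk⟩
  rw [Matrix.mul_apply]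
  simp only [Matrix.diagonal_mul, Matrix.conjTranspose_apply]
  rcases j with _ | l
  · rw [Finset.sum_eq_zero fun i _ => by rw [Amat_apply_of_ne _ (by simp), zero_mul]]
    by_cases h : 0 = k <;> simp [Matrix.diagonal, h]
  · rw [Finset.sum_eq_single ⟨l, by omega⟩
      (fun i _ hi => by
        rw [Amat_apply_of_ne _ (by simp only [ne_eq, Fin.ext_iff] at hi ⊢; omega), zero_mul])
      (by simp)]
    by_cases h : l + 1 = k
    · subst h
      have := μch_div_sq (N := N) ha hj
      rw [Amat_apply_succ _ hj, Matrix.diagonal_apply_eq, if_neg (by simp)]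
      simp only [RCLike.star_def, Complex.conj_ofReal]
      rw [mul_left_comm, ← pow_two, ← Complex.ofReal_pow, this]
      push_cast
      simp
    · rw [Amat_apply_of_ne (j := ⟨k, hk⟩) _ (by simp only [ne_eq]; omega),
        Matrix.diagonal_apply_ne _ (by simpa using h)]
      simp

lemma conjTranspose_Amat_mul_self (ha : 0 < a) :
    (Amat N (μch N a))ᴴ * Amat N (μch N a)
      = Matrix.diagonal fun j : Fin N => ((N - ((j : ℕ) + 1)) / a : ℂ) := by
  ext ⟨j, hj⟩ ⟨k, hk⟩
  rw [Matrix.mul_apply]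
  simp only [Matrix.conjTranspose_apply]
  by_cases hjN : j + 1 < N
  · rw [Finset.sum_eq_single ⟨j + 1, hjN⟩
      (fun i _ hi => by
        rw [Amat_apply_of_ne (k := ⟨j, hj⟩) _ (by simpa [Fin.ext_iff] using hi)]; simp)
      (by simp)]
    by_cases h : j = k
    · subst h
      have := μch_div_sq (N := N) ha hjN
      rw [Amat_apply_succ _ hjN, Matrix.diagonal_apply_eq]
      simp only [RCLike.star_def, Complex.conj_ofReal]
      rw [← pow_two, ← Complex.ofReal_pow, this]
      push_cast
      ring
    · rw [Amat_apply_of_ne (k := ⟨k, hk⟩) _ (by simpa using h),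
        Matrix.diagonal_apply_ne _ (by simpa using h)]
      simp
  · rw [Finset.sum_eq_zero fun i _ => by
      rw [Amat_apply_of_ne (k := ⟨j, hj⟩) _ (by have := i.2; simp only [ne_eq]; omega)]; simp]
    by_cases h : j = k
    · subst h
      have : (N : ℂ) = j + 1 := by exact_mod_cast (by omega : N = j + 1)
      rw [Matrix.diagonal_apply_eq, this]
      simp
    · rw [Matrix.diagonal_apply_ne _ (by simpa using h)]

lemma Jdiag_mul_Amat (μ : ℕ → ℝ) : Jdiag N * Amat N μ = Amat N μ * Jdiag N + Amat N μ := by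
  ext j k
  rw [Jdiag, Matrix.diagonal_mul, Matrix.add_apply, Matrix.mul_diagonal]
  by_cases h : (j : ℕ) = k + 1
  · rw [h]; push_cast; ring
  · rw [Amat_apply_of_ne _ h]; simp

lemma Jdiag_conjTranspose : (Jdiag N)ᴴ = Jdiag N := by
  rw [Jdiag, Matrix.diagonal_conjTranspose]
  congr 1; ext j; simp

lemma Jdiag_mul_raising (μ : ℕ → ℝ) :
    Jdiag N * (Jdiag N * (Amat N μ)ᴴ)
      = Jdiag N * (Amat N μ)ᴴ * Jdiag N - Jdiag N * (Amat N μ)ᴴ := by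
  have h := congrArg Matrix.conjTranspose (Jdiag_mul_Amat (N := N) μ)
  simp only [Matrix.conjTranspose_mul, Matrix.conjTranspose_add, Jdiag_conjTranspose] at h
  rw [mul_assoc, h]
  noncomm_ring

/-- The `sl₂` relation between `A`, `J A^*` and `2J - N - 1`. -/
lemma Amat_mul_raising (ha : 0 < a) :
    Amat N (μch N a) * (Jdiag N * (Amat N (μch N a))ᴴ)
      = Jdiag N * (Amat N (μch N a))ᴴ * Amat N (μch N a)
        + (1 / a : ℂ) • ((2 : ℂ) • Jdiag N - ((N : ℂ) + 1) • 1) := by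
  rw [mul_assoc, conjTranspose_Amat_mul_self ha]
  have h := Amat_mul_diagonal_mul_conjTranspose (N := N) ha fun j => (j : ℂ) + 1
  rw [Jdiag, h, Matrix.diagonal_mul_diagonal]
  have ha' : (a : ℂ) ≠ 0 := by exact_mod_cast ha.ne'
  ext j k
  by_cases hjk : j = k
  · subst hjk
    rcases j with ⟨_ | j, hj⟩ <;> simp <;> field_simp <;> ring
  · simp [hjk]

lemma Tmat_succ (lam : ℕ) :
    Tmat N (δch a (lam + 1))
      = (a / 2 : ℂ) • (((lam : ℂ) • 1 + Jdiag N) * Tmat N (δch a lam)) := by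
  ext j k
  by_cases hjk : j = k
  · subst hjk
    simp only [Tmat, Jdiag, δch, add_mul, smul_mul_assoc, one_mul, Matrix.diagonal_mul_diagonal,
      Matrix.diagonal_apply_eq, Matrix.smul_apply, Matrix.add_apply, smul_eq_mul]
    rw [show lam + 1 + (j + 1) - 1 = lam + j + 1 by omega,
      show lam + ((j : ℕ) + 1) - 1 = lam + j by omega, Nat.factorial_succ]
    push_cast
    ring
  · simp [Tmat, Jdiag, add_mul, hjk]

lemma Tmat_succ_mul_conjTranspose (μ : ℕ → ℝ) (lam : ℕ) :
    Tmat N (δch a (lam + 1)) * (Amat N μ)ᴴ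
      = (a / 2 : ℂ) • (Jdiag N * (Amat N μ)ᴴ * Tmat N (δch a lam)) := by
  ext j k
  rw [Tmat, Jdiag, Tmat, Matrix.smul_apply, Matrix.mul_diagonal, Matrix.diagonal_mul,
    Matrix.diagonal_mul, Matrix.conjTranspose_apply]
  by_cases h : (k : ℕ) = j + 1
  · have h1 : ((j : ℕ).factorial : ℂ) ≠ 0 := by exact_mod_cast (j : ℕ).factorial_ne_zero
    have h2 : ((j : ℕ) : ℂ) + 1 ≠ 0 := by exact_mod_cast (j : ℕ).succ_ne_zero
    rw [δch, δch, h, show lam + 1 + ((j : ℕ) + 1) - 1 = lam + j + 1 by omega,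
      show lam + ((j : ℕ) + 1 + 1) - 1 = lam + j + 1 by omega, Nat.add_sub_cancel,
      Nat.add_sub_cancel, Nat.factorial_succ j]
    push_cast
    rw [smul_eq_mul]
    field_simp
    ring
  · rw [Amat_apply_of_ne _ h]; simp

lemma Tmat_succ_mul_one_add (μ : ℕ → ℝ) (lam : ℕ) :
    Tmat N (δch a (lam + 1)) * (1 + (Amat N μ)ᴴ)
      = (a / 2 : ℂ) • (((lam : ℂ) • 1 + Jdiag N + Jdiag N * (Amat N μ)ᴴ)
        * Tmat N (δch a lam)) := by
  rw [mul_add, Tmat_succ_mul_conjTranspose, mul_one, Tmat_succ, ← smul_add, ← add_mul]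

lemma μch_pos (ha : 0 < a) (j : ℕ) : 0 < μch N a j := by
  unfold μch; positivity

lemma δch_pos (ha : 0 < a) (lam k : ℕ) : 0 < δch a lam k := by
  unfold δch; positivity

lemma Amat_pow_apply {μ : ℕ → ℝ} (hμ : ∀ j, μ j ≠ 0) (m : ℕ) (j k : Fin N) :
    (Amat N μ ^ m) j k
      = if (j : ℕ) = k + m then ((μ ((j : ℕ) + 1) / μ ((k : ℕ) + 1) : ℝ) : ℂ) else 0 := by
  induction m generalizing k with
  | zero =>
    by_cases h : j = k
    · subst h; simp [hμ]
    · simp [h, Fin.ext_iff.not.1 h]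
  | succ m ih =>
    rw [pow_succ, Matrix.mul_apply]
    by_cases hk : (k : ℕ) + 1 < N
    · rw [Finset.sum_eq_single ⟨k + 1, hk⟩
        (fun i _ hi => by
          rw [Amat_apply_of_ne _ (by simpa [Fin.ext_iff] using hi), mul_zero]) (by simp),
        ih, Amat_apply_succ _ hk]
      by_cases h : (j : ℕ) = k + 1 + m
      · have hk2 := hμ (k + 1 + 1)
        rw [if_pos h, if_pos (by omega), ← Complex.ofReal_mul]
        congr 1
        field_simp
      · rw [if_neg h, if_neg (by omega), zero_mul]
    · rw [if_neg (by have := j.2; omega)]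
      refine Finset.sum_eq_zero fun i _ => ?_
      rw [Amat_apply_of_ne _ (by have := i.2; omega), mul_zero]

lemma Amat_pow_eq_zero {μ : ℕ → ℝ} (hμ : ∀ j, μ j ≠ 0) : Amat N μ ^ N = 0 := by
  ext j k
  rw [Amat_pow_apply hμ, if_neg (by have := j.2; omega), Matrix.zero_apply]

lemma charlier_zero_right (c : ℂ) (n : ℕ) : charlier c n 0 = 1 := by
  rw [charlier, Finset.sum_eq_single 0 (fun k _ hk => by simp [hk])
    (by simp)]
  simp

lemma Lmat_zero_eq_sum {μ : ℕ → ℝ} (hμ : ∀ j, μ j ≠ 0) {n : ℕ} (hn : N ≤ n) :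
    Lmat N a μ 0
      = ∑ k ∈ Finset.range n, ((-(a : ℂ)) ^ k / (k.factorial : ℂ)) • Amat N μ ^ k := by
  ext j k
  rw [Matrix.sum_apply]
  simp only [Matrix.smul_apply, Amat_pow_apply hμ, Lmat, Matrix.of_apply, charlier_zero_right]
  have hj := j.2
  by_cases h : (k : ℕ) ≤ j
  · rw [if_pos h, Finset.sum_eq_single ((j : ℕ) - k)
      (fun m _ hm => by rw [if_neg (by omega), smul_zero])
      (fun hm => absurd (Finset.mem_range.2 (by omega)) hm), if_pos (by omega), smul_eq_mul]
    ring
  · rw [if_neg h, Finset.sum_eq_zero fun m _ => by rw [if_neg (by omega), smul_zero]]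

lemma isUnit_Lmat_zero {μ : ℕ → ℝ} (hμ : ∀ j, μ j ≠ 0) : IsUnit (Lmat N a μ 0) := by
  rw [Lmat_zero_eq_sum hμ (Nat.le_succ N), Finset.sum_range_succ', add_comm]
  simp only [pow_succ (Amat N μ), ← smul_mul_assoc]
  rw [pow_zero, pow_zero, Nat.factorial_zero, Nat.cast_one, div_one, one_smul, ← Finset.sum_mul]
  refine IsNilpotent.isUnit_one_add (Commute.isNilpotent_mul_left ?_ ⟨N, Amat_pow_eq_zero hμ⟩)
  refine Commute.sum_left _ _ _ fun k _ => ?_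
  exact ((Commute.refl (Amat N μ)).pow_left k).smul_left _

lemma isUnit_one_add_Amat {μ : ℕ → ℝ} (hμ : ∀ j, μ j ≠ 0) : IsUnit (1 + Amat N μ) :=
  IsNilpotent.isUnit_one_add ⟨N, Amat_pow_eq_zero hμ⟩

lemma Wch_factor (ha : 0 < a) (μ : ℕ → ℝ) (lam x : ℕ) :
    ∃ C : Mat N, IsUnit C ∧ Wch N a μ (δch a lam) lam x
      = ((a ^ x / x.factorial : ℝ) : ℂ) •
        (((1 + Amat N μ) ^ (x + lam) * C) * ((1 + Amat N μ) ^ (x + lam) * C)ᴴ) := by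
  refine ⟨Tmat N fun k => Real.sqrt (δch a lam k), ?_, ?_⟩
  · rw [Tmat, Matrix.isUnit_diagonal, Pi.isUnit_iff]
    intro k
    have := (Real.sqrt_pos.2 (δch_pos ha lam (k + 1))).ne'
    exact isUnit_iff_ne_zero.2 (by exact_mod_cast this)
  · have h1 : (Tmat N fun k => Real.sqrt (δch a lam k))ᴴ = Tmat N fun k => √(δch a lam k) := by
      rw [Tmat, Matrix.diagonal_conjTranspose]
      congr 1; ext j; simp
    have h2 : Tmat N (δch a lam)
        = (Tmat N fun k => √(δch a lam k)) * Tmat N fun k => √(δch a lam k) := by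
      rw [Tmat, Tmat, Matrix.diagonal_mul_diagonal]
      congr 1; ext j
      rw [← Complex.ofReal_mul, Real.mul_self_sqrt (δch_pos ha _ _).le]
    rw [Wch, Matrix.conjTranspose_mul, h1, h2, Matrix.conjTranspose_pow, Matrix.conjTranspose_add,
      Matrix.conjTranspose_one]
    simp only [mul_assoc]

lemma Wch_posSemidef (ha : 0 < a) (μ : ℕ → ℝ) (lam x : ℕ) :
    (Wch N a μ (δch a lam) lam x).PosSemidef := by
  obtain ⟨C, -, hC⟩ := Wch_factor (N := N) ha μ lam x
  rw [hC]
  refine (Matrix.posSemidef_self_mul_conjTranspose _).smul ?_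
  exact_mod_cast (by positivity : (0 : ℝ) ≤ a ^ x / x.factorial)

lemma Wch_zero_factor (ha : 0 < a) {μ : ℕ → ℝ} (hμ : ∀ j, μ j ≠ 0) (lam : ℕ) :
    ∃ Y, IsUnit Y ∧ Wch N a μ (δch a lam) lam 0 = Y * Yᴴ := by
  obtain ⟨C, hC, h⟩ := Wch_factor (N := N) ha μ lam 0
  exact ⟨_, ((isUnit_one_add_Amat hμ).pow _).mul hC, by simpa using h⟩

end Parameters

section Recursion

variable {N : ℕ} {a : ℝ}

lemma commute_of_commute_of_inverse {R : Type*} [Ring R] {u v x : R} (huv : u * v = 1)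
    (hvu : v * u = 1) (h : x * u = u * x) : x * v = v * x := by
  calc x * v = v * (u * x) * v := by rw [← mul_assoc v, hvu, one_mul]
    _ = v * (x * u) * v := by rw [h]
    _ = v * x := by rw [mul_assoc, mul_assoc, huv, mul_one]

/-- Value at zero of the Pearson relation for the matrix Charlier weights, in terms of
`U = (I+A)⁻¹`. -/
lemma charlier_lead_mul_eval_zero (ha : 0 < a) {P : ℕ → ℕ → Polynomial (Mat N)}
    (hP : ∀ lam : ℕ, IsMOSN (Wch N a (μch N a) (δch a lam) lam) (P lam)) {U : Mat N}
    (hEU : (1 + Amat N (μch N a)) * U = 1) (hUE : U * (1 + Amat N (μch N a)) = 1)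
    (lam m : ℕ) :
    ∃ M₀ : Mat N,
      M₀ * (1 + Amat N (μch N a)) ^ lam = (a / 2 : ℂ) • ((1 + Amat N (μch N a)) ^ (lam + 1)
        * ((lam : ℂ) • 1 + Jdiag N + Jdiag N * (Amat N (μch N a))ᴴ)) ∧
      (1 / 2 : ℂ) • (Jdiag N - ((N : ℂ) + 1 + lam) • 1 - (a : ℂ) • Amat N (μch N a)
          - ((m + 1 + lam : ℕ) : ℂ) • (Amat N (μch N a) * U)) * matEval (P lam (m + 1)) 0
        = matEval (P (lam + 1) m) 0 * M₀ := by
  have ha' : (a : ℂ) ≠ 0 := by exact_mod_cast ha.ne'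
  have hμ : ∀ j, μch N a j ≠ 0 := fun j => (μch_pos ha j).ne'
  have hJA := Jdiag_mul_Amat (N := N) (μch N a)
  have hAX := Amat_mul_raising (N := N) ha
  have hT := Tmat_succ (N := N) (a := a) lam
  have hTE := Tmat_succ_mul_one_add (N := N) (a := a) (μch N a) lam
  have hrec := fun M B K₀ K₁ B₁ B₂ => (hP lam).lead_mul_eval_zero (hP (lam + 1))
    (hasMoments_Wch a _ _ lam) (hasMoments_Wch a _ _ (lam + 1)) (Wch_posSemidef ha _ lam)
    (Wch_zero_factor ha hμ lam) (M := M) (B := B) (K₀ := K₀) (K₁ := K₁) (B₁ := B₁) (B₂ := B₂)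
  have hW : ∀ x lam, Wch N a (μch N a) (δch a lam) lam x = ((a ^ x / x.factorial : ℝ) : ℂ) •
    ((1 + Amat N (μch N a)) ^ (x + lam) * (Tmat N (δch a lam)
      * (1 + (Amat N (μch N a))ᴴ) ^ (x + lam))) := fun x lam => by rw [Wch, mul_assoc]
  simp only [hW] at hrec
  generalize Amat N (μch N a) = A at *
  generalize (1 + Aᴴ) = F at *
  generalize Jdiag N * Aᴴ = X at *
  generalize Tmat N (δch a lam) = T at *
  generalize Tmat N (δch a (lam + 1)) = T' at *
  generalize Jdiag N = J at *
  obtain ⟨H, hH⟩ : ∃ H, H = (2 : ℂ) • J - ((N : ℂ) + 1) • (1 : Mat N) := ⟨_, rfl⟩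
  rw [← hH] at hAX
  obtain ⟨E, hE⟩ : ∃ E, E = 1 + A := ⟨_, rfl⟩
  have hUA : U * A = A * U :=
    (commute_of_commute_of_inverse hEU hUE (by noncomm_ring)).symm
  simp only [← hE] at hEU hUE hrec ⊢
  have hEJ : E * J = (J - A * U) * E := by
    rw [sub_mul, mul_assoc, hUE, hE, mul_add, hJA]
    noncomm_ring
  have hEV : E * (A * U) = A * U * E := by
    rw [mul_assoc, hUE, mul_one, ← hUA, ← mul_assoc, hEU, one_mul]
  have hEX : E * X = X * E + (1 / a : ℂ) • H := by
    rw [hE, add_mul, hAX, mul_add]; noncomm_ring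
  have hHE : H * E = E * H + (2 : ℂ) • A := by
    rw [hE, hH]
    simp only [mul_add, add_mul, sub_mul, mul_sub, smul_mul_assoc, mul_smul_comm, hJA, one_mul,
      mul_one]
    module
  have hpJ := pow_mul_eq_sub_smul_mul_pow hEJ hEV
  have hpX := pow_mul_eq_quadratic_mul_pow hEX hHE hEU hUE hUA
  set M : ℂ → Mat N := fun x => (a / 2 : ℂ) • ((lam : ℂ) • E + E * J - (x + lam) • A + E * X
    + ((x + lam) / a) • H - ((x + lam) * (x + lam + 1) / a) • (A * U)) with hM
  set B : ℂ → Mat N := fun x => (x / 2) • ((lam : ℂ) • 1 + J - (x + lam) • (A * U)) with hB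
  have hMpow : ∀ x : ℕ, M x * E ^ (x + lam)
      = (a / 2 : ℂ) • (E ^ (x + lam + 1) * ((lam : ℂ) • 1 + J + X)) := by
    intro x
    have h : M x = (a / 2 : ℂ) • (E * ((lam : ℂ) • 1 + (J - ((x + lam : ℕ) : ℂ) • (A * U))
      + (X + (((x + lam : ℕ) : ℂ) * (1 / a)) • (U * H)
        - (((x + lam : ℕ) : ℂ) * (((x + lam : ℕ) : ℂ) + 1) * (1 / a)) • (U * (A * U))))) := by
      have e1 : E * (A * U) = A := by rw [hEV, mul_assoc, hUE, mul_one]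
      have e2 : E * (U * H) = H := by rw [← mul_assoc, hEU, one_mul]
      have e3 : E * (U * (A * U)) = A * U := by rw [← mul_assoc, hEU, one_mul]
      simp only [hM, mul_add, mul_sub, mul_smul_comm, e1, e2, e3, mul_one]
      push_cast
      module
    rw [h, pow_succ', smul_mul_assoc, mul_assoc E, mul_assoc E]
    congr 2
    rw [mul_add (E ^ _), mul_add (E ^ _), hpJ, hpX, mul_smul_comm, mul_one, add_mul _ _ (E ^ _),
      add_mul _ _ (E ^ _), smul_mul_assoc,
      one_mul]
  have hfac : ∀ x : ℕ, (x.factorial : ℂ) ≠ 0 := fun x => by exact_mod_cast x.factorial_ne_zero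
  refine ⟨M 0, by simpa using hMpow 0, ?_⟩
  have := hrec M B
    ((a / 2 : ℂ) • ((lam : ℂ) • E + E * J - (lam : ℂ) • A + E * X + (lam / a : ℂ) • H
      - (lam * (lam + 1) / a : ℂ) • (A * U)))
    ((a / 2 : ℂ) • (-A + (1 / a : ℂ) • H - ((2 * lam + 1) / a : ℂ) • (A * U))
      - (1 / 2 : ℂ) • ((lam : ℂ) • 1 + J - (lam : ℂ) • (A * U)))
    ((1 / 2 : ℂ) • ((lam : ℂ) • 1 + J - (lam : ℂ) • (A * U))) (-(1 / 2 : ℂ) • (A * U))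
    ?_ ?_ ?_ ?_ m
  · rw [← this]
    congr 1
    rw [hH]
    push_cast
    match_scalars <;> field_simp <;> ring
  · intro x
    simp only [hM, hB]
    match_scalars <;> field_simp <;> ring
  · intro x
    simp only [hB]
    match_scalars <;> ring
  · intro x
    rw [mul_smul_comm, ← mul_assoc, hMpow, ← add_assoc]
    congr 1
    rw [pow_succ' F, ← mul_assoc T', hTE]
    simp only [smul_mul_assoc, mul_smul_comm, mul_assoc]
  · intro x
    have h1 : x + 1 + lam = x + (lam + 1) := by ring
    have h2 : ((lam : ℂ) • 1 + J - ((x : ℂ) + 1 + lam) • (A * U)) * E ^ (x + (lam + 1))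
        = E ^ (x + (lam + 1)) * ((lam : ℂ) • 1 + J) := by
      rw [mul_add, hpJ, mul_smul_comm, mul_one]
      simp only [add_mul, sub_mul, smul_mul_assoc, one_mul]
      push_cast
      module
    simp only [hB]
    rw [h1, mul_smul_comm, smul_mul_assoc, ← mul_assoc, h2, hT]
    simp only [smul_mul_assoc, mul_smul_comm, mul_assoc, smul_smul]
    congr 1
    have h3 := hfac x
    have h4 : (x : ℂ) + 1 ≠ 0 := by exact_mod_cast x.succ_ne_zero
    rw [Nat.factorial_succ]
    push_cast
    field_simp
    ring

end Recursion

section Solution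

lemma Acal_relations {N : ℕ} {a : ℝ} (lam m : ℕ) :
    (((N : ℂ) + lam) • 1 - Jdiag N) * (1 + Acal N a (m + 1 + lam))
        + ((m : ℂ) + 1) • (1 + Acal N a (m + 1 + lam))
      = ((N : ℂ) + lam) • 1 - Jdiag N + ((m : ℂ) + 1) • 1 + Jdiag N * (Amat N (μch N a))ᴴ ∧
    (((N : ℂ) + lam) • 1 - Jdiag N) * (1 + Acal N a (m + 1 + lam))
      = (1 + Acal N a (m + 1 + lam)) * (((N : ℂ) + lam) • 1 - Jdiag N)
        + ((1 + Acal N a (m + 1 + lam)) - 1) := by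
  have hX := Jdiag_mul_raising (N := N) (μch N a)
  have hunit : IsUnit (((N : ℂ) + ((m + 1 + lam : ℕ) : ℂ)) • (1 : Mat N) - Jdiag N) := by
    rw [Jdiag, ← Matrix.diagonal_one, ← Matrix.diagonal_smul, Matrix.diagonal_sub,
      Matrix.isUnit_diagonal, Pi.isUnit_iff]
    intro j
    refine isUnit_iff_ne_zero.2 ?_
    obtain ⟨d, hd⟩ : ∃ d, N = j + 1 + d := ⟨N - (j + 1), by have := j.2; omega⟩
    have hd' : (N : ℂ) = (j : ℕ) + 1 + d := by exact_mod_cast hd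
    have : ((d + m + 1 + lam : ℕ) : ℂ) ≠ 0 := by
      exact_mod_cast (by omega : d + m + 1 + lam ≠ 0)
    convert this using 1
    simp only [Pi.smul_apply, smul_eq_mul, hd']
    push_cast
    ring
  rw [Acal]
  generalize Jdiag N * (Amat N (μch N a))ᴴ = X at *
  obtain ⟨Z, hZ⟩ : ∃ Z, Z = ((N : ℂ) + ((m + 1 + lam : ℕ) : ℂ)) • (1 : Mat N) - Jdiag N :=
    ⟨_, rfl⟩
  rw [← hZ] at hunit ⊢
  have hdet := (Matrix.isUnit_iff_isUnit_det _).1 hunit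
  have hY : ((N : ℂ) + lam) • (1 : Mat N) - Jdiag N = Z - ((m : ℂ) + 1) • 1 := by
    rw [hZ]; push_cast; module
  have hZX : Z * X = X * Z + X := by
    rw [hZ, sub_mul, mul_sub, hX, smul_mul_assoc, mul_smul_comm, one_mul, mul_one]; abel
  have h1 : Z * (Z⁻¹ * X) = X := by rw [← mul_assoc, Matrix.mul_nonsing_inv _ hdet, one_mul]
  have h2 : Z⁻¹ * X * Z = X - Z⁻¹ * X := by
    rw [mul_assoc, eq_sub_of_add_eq hZX.symm, mul_sub, ← mul_assoc, Matrix.nonsing_inv_mul _ hdet,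
      one_mul]
  rw [hY]
  constructor
  · rw [mul_add, sub_mul, sub_mul, h1]
    simp only [smul_mul_assoc, one_mul, mul_one]
    module
  · rw [mul_add, sub_mul, sub_mul, h1, add_mul, mul_sub, mul_sub, h2]
    simp only [smul_mul_assoc, mul_smul_comm, one_mul, mul_one]
    module

/-- Conjugation of the leading coefficient to a diagonal matrix. -/
lemma lead_mul_conjugator {R : Type*} [Ring R] [Algebra ℂ R] {A J U L Li : R} {a : ℂ}
    (hJA : J * A = A * J + A) (hEU : (1 + A) * U = 1) (hUE : U * (1 + A) = 1)
    (hLLi : L * Li = 1) (hLiL : Li * L = 1) (hLA : L * A = A * L)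
    (hLJ : L * J = (J + a • A) * L) (ν : ℕ) (t : ℂ) :
    (J - t • 1 - a • A - (ν : ℂ) • (A * U)) * (Li * (1 + A) ^ ν)
      = Li * (1 + A) ^ ν * (J - t • 1) := by
  have hUA : U * A = A * U :=
    (commute_of_commute_of_inverse hEU hUE (by noncomm_ring)).symm
  have hLiA : A * Li = Li * A := commute_of_commute_of_inverse hLLi hLiL hLA.symm
  have hLiU : U * Li = Li * U := by
    refine commute_of_commute_of_inverse hLLi hLiL ?_
    refine (commute_of_commute_of_inverse hEU hUE ?_).symm
    rw [mul_add, hLA]; noncomm_ring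
  have hLiJ : (J - a • A) * Li = Li * J := by
    have : Li * (L * J) * Li = Li * ((J + a • A) * L) * Li := by rw [hLJ]
    rw [← mul_assoc, hLiL, one_mul, mul_assoc, mul_assoc (J + a • A), hLLi, mul_one, mul_add,
      mul_smul_comm, ← hLiA] at this
    rw [sub_mul, this, smul_mul_assoc]; abel
  have hEJ : (1 + A) * J = (J - A * U) * (1 + A) := by
    rw [sub_mul, mul_assoc A, hUE, mul_add J, hJA]; noncomm_ring
  have hEV : (1 + A) * (A * U) = A * U * (1 + A) := by
    rw [mul_assoc, hUE, mul_one, ← hUA, ← mul_assoc, hEU, one_mul]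
  have hp := pow_mul_eq_sub_smul_mul_pow hEJ hEV ν
  have hVLi : A * U * Li = Li * (A * U) := by
    rw [mul_assoc, hLiU, ← mul_assoc, hLiA, mul_assoc]
  calc (J - t • 1 - a • A - (ν : ℂ) • (A * U)) * (Li * (1 + A) ^ ν)
      = ((J - a • A) * Li - (ν : ℂ) • (A * U * Li) - t • Li) * (1 + A) ^ ν := by
        rw [← mul_assoc]
        simp only [sub_mul, smul_mul_assoc, one_mul]
        abel
    _ = Li * ((J - (ν : ℂ) • (A * U)) * (1 + A) ^ ν) - t • (Li * (1 + A) ^ ν) := by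
        rw [hLiJ, hVLi]
        simp only [sub_mul, mul_sub, smul_mul_assoc, mul_smul_comm, mul_assoc]
    _ = _ := by
        rw [← hp, mul_sub, mul_smul_comm, mul_one, mul_assoc]

lemma Lmat_zero_relations {N : ℕ} {a : ℝ} (ha : 0 < a) :
    let A := Amat N (μch N a)
    let X := Jdiag N * Aᴴ
    let L := Lmat N a (μch N a) 0
    L * A = A * L ∧ L * Jdiag N = (Jdiag N + (a : ℂ) • A) * L ∧
      L * (Jdiag N + X) = (((N : ℂ) + 1) • 1 - Jdiag N + X) * L := by
  intro A X L
  have ha' : (a : ℂ) ≠ 0 := by exact_mod_cast ha.ne'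
  have hμ : ∀ j, μch N a j ≠ 0 := fun j => (μch_pos ha j).ne'
  have hJA : Jdiag N * A = A * Jdiag N + A := Jdiag_mul_Amat (μch N a)
  have hAX := Amat_mul_raising (N := N) ha
  have hA0 : A ^ N = 0 := Amat_pow_eq_zero hμ
  have hHA : ((2 : ℂ) • Jdiag N - ((N : ℂ) + 1) • 1) * A
      = A * ((2 : ℂ) • Jdiag N - ((N : ℂ) + 1) • 1) + (2 : ℂ) • A := by
    simp only [sub_mul, mul_sub, smul_mul_assoc, mul_smul_comm, hJA, one_mul, mul_one]
    module
  have hLA : L * A = A * L := by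
    simp only [L, Lmat_zero_eq_sum hμ le_rfl, Finset.sum_mul, Finset.mul_sum, smul_mul_assoc,
      mul_smul_comm]
    exact Finset.sum_congr rfl fun k _ => by rw [← pow_succ, ← pow_succ']
  have hLJ : L * Jdiag N = (Jdiag N + (a : ℂ) • A) * L := by
    have := exp_sum_mul_raising hJA (-(a : ℂ)) hA0
    rw [← Lmat_zero_eq_sum hμ (Nat.le_succ N)] at this
    rw [this, neg_smul, sub_neg_eq_add]
  have hLX := exp_sum_mul_lowering (b := -(a : ℂ)) (by field_simp) hAX hHA hA0
  rw [← Lmat_zero_eq_sum hμ (by omega)] at hLX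
  refine ⟨hLA, hLJ, ?_⟩
  change X * L = L * (X + _) + (-(a : ℂ)) • (A * L) at hLX
  rw [mul_add, add_mul, hLX, hLJ]
  simp only [mul_add, mul_sub, add_mul, sub_mul, mul_smul_comm, smul_mul_assoc, hLJ, one_mul,
    mul_one]
  module

lemma charlier_value_at_zero_of_monic_orthogonal {N : ℕ} {a : ℝ} (ha : 0 < a)
    {P : ℕ → ℕ → Polynomial (Mat N)}
    (hP : ∀ lam : ℕ, IsMOSN (Wch N a (μch N a) (δch a lam) lam) (P lam)) (n lam : ℕ) :
    matEval (P lam n) 0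
        = (-(a : ℂ)) ^ n • ((Lmat N a (μch N a) 0)⁻¹ * (1 + Amat N (μch N a)) ^ (n + lam)
            * (1 + Acal N a (n + lam)) ^ n * ((1 + Amat N (μch N a)) ^ lam)⁻¹
            * Lmat N a (μch N a) 0) := by
  have hμ : ∀ j, μch N a j ≠ 0 := fun j => (μch_pos ha j).ne'
  have hLu : IsUnit (Lmat N a (μch N a) 0) := isUnit_Lmat_zero hμ
  have hEu : IsUnit (1 + Amat N (μch N a)) := isUnit_one_add_Amat hμ
  have hLd := (Matrix.isUnit_iff_isUnit_det _).1 hLu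
  have hEd := (Matrix.isUnit_iff_isUnit_det _).1 hEu
  have hEpd : ∀ k, IsUnit ((1 + Amat N (μch N a)) ^ k).det := fun k =>
    (Matrix.isUnit_iff_isUnit_det _).1 (hEu.pow k)
  induction n generalizing lam with
  | zero =>
    have : matEval (P lam 0) 0 = 1 := by
      have h := (hP lam).hasLead 0
      have h' : (fun x => matEval (P lam 0) x - x ^ 0 • (1 : Mat N)) = 0 := by
        simpa [HasLead, polyLT] using h
      simpa [sub_eq_zero] using congrFun h' 0
    rw [this, zero_add, pow_zero, pow_zero, one_smul, mul_one,
      mul_assoc (Lmat N a (μch N a) 0)⁻¹, Matrix.mul_nonsing_inv _ (hEpd lam), mul_one,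
      Matrix.nonsing_inv_mul _ hLd]
  | succ m ih =>
    obtain ⟨M₀, hM₀, hrec⟩ := charlier_lead_mul_eval_zero ha hP
      (Matrix.mul_nonsing_inv _ hEd) (Matrix.nonsing_inv_mul _ hEd) lam m
    obtain ⟨hLA, hLJ, hLX⟩ := Lmat_zero_relations (N := N) ha
    obtain ⟨hG, hY⟩ := Acal_relations (N := N) (a := a) lam m
    have hconj := lead_mul_conjugator (Jdiag_mul_Amat (N := N) (μch N a))
      (Matrix.mul_nonsing_inv _ hEd) (Matrix.nonsing_inv_mul _ hEd)
      (Matrix.mul_nonsing_inv _ hLd) (Matrix.nonsing_inv_mul _ hLd) hLA hLJ (m + 1 + lam)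
      ((N : ℂ) + 1 + lam)
    have hpow := pow_mul_eq_mul_pow_succ hG hY m rfl
    have hDu : IsUnit (Jdiag N - ((N : ℂ) + 1 + lam) • 1) := by
      rw [Jdiag, ← Matrix.diagonal_one, ← Matrix.diagonal_smul, Matrix.diagonal_sub,
        Matrix.isUnit_diagonal, Pi.isUnit_iff]
      intro j
      refine isUnit_iff_ne_zero.2 ?_
      obtain ⟨d, hd⟩ : ∃ d, N = j + 1 + d := ⟨N - (j + 1), by have := j.2; omega⟩
      have hd' : (N : ℂ) = (j : ℕ) + 1 + d := by exact_mod_cast hd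
      have : -((d + 1 + lam : ℕ) : ℂ) ≠ 0 := neg_ne_zero.2 (by
        exact_mod_cast (by omega : d + 1 + lam ≠ 0))
      convert this using 1
      simp only [Pi.smul_apply, smul_eq_mul, hd']
      push_cast
      ring
    have hSu : IsUnit ((Lmat N a (μch N a) 0)⁻¹ * (1 + Amat N (μch N a)) ^ (m + 1 + lam)) :=
      (Matrix.isUnit_nonsing_inv_iff.2 hLu).mul (hEu.pow _)
    have hKu := hSu.mul hDu
    rw [← hconj] at hKu
    have hKu' := (hSu.mul_right_iff).1 hKu
    have hi := ih (lam + 1)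
    rw [show m + (lam + 1) = m + 1 + lam by ring] at hi
    rw [hi, smul_mul_assoc (1 / 2 : ℂ)] at hrec
    have hEL : Lmat N a (μch N a) 0 * (1 + Amat N (μch N a)) ^ lam
        = (1 + Amat N (μch N a)) ^ lam * Lmat N a (μch N a) 0 :=
      Commute.pow_right (by rw [Commute, SemiconjBy, mul_add, hLA]; noncomm_ring) lam
    have hEL' : Lmat N a (μch N a) 0 * (1 + Amat N (μch N a)) ^ (lam + 1)
        = (1 + Amat N (μch N a)) ^ (lam + 1) * Lmat N a (μch N a) 0 :=
      Commute.pow_right (by rw [Commute, SemiconjBy, mul_add, hLA]; noncomm_ring) (lam + 1)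
    have hELi := commute_of_commute_of_inverse (Matrix.mul_nonsing_inv _ (hEpd lam))
      (Matrix.nonsing_inv_mul _ (hEpd lam)) hEL
    have h1 := Matrix.mul_nonsing_inv _ (hEpd lam)
    have h2 := Matrix.nonsing_inv_mul _ (hEpd (lam + 1))
    have hM : M₀ = (a / 2 : ℂ) • ((1 + Amat N (μch N a)) ^ (lam + 1)
        * ((lam : ℂ) • 1 + Jdiag N + Jdiag N * (Amat N (μch N a))ᴴ)
        * ((1 + Amat N (μch N a)) ^ lam)⁻¹) := by
      rw [← smul_mul_assoc, ← hM₀, mul_assoc, h1, mul_one]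
    have hLX' : Lmat N a (μch N a) 0
          * ((lam : ℂ) • 1 + Jdiag N + Jdiag N * (Amat N (μch N a))ᴴ)
        = (((N : ℂ) + lam) • 1 - Jdiag N + 1 + Jdiag N * (Amat N (μch N a))ᴴ)
          * Lmat N a (μch N a) 0 := by
      rw [add_assoc, mul_add, hLX, mul_smul_comm, mul_one]
      simp only [add_mul, sub_mul, smul_mul_assoc, one_mul]
      module
    have hD : Jdiag N - ((N : ℂ) + 1 + lam) • (1 : Mat N)
        = -(((N : ℂ) + lam) • 1 - Jdiag N + 1) := by module
    generalize (Jdiag N - ((N : ℂ) + 1 + lam) • 1 - (a : ℂ) • Amat N (μch N a)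
          - ((m + 1 + lam : ℕ) : ℂ) • (Amat N (μch N a) * (1 + Amat N (μch N a))⁻¹)) = K at *
    rw [← hKu'.mul_right_inj]
    have hrec' : K * matEval (P lam (m + 1)) 0 = (2 : ℂ) • ((1 / 2 : ℂ) •
      (K * matEval (P lam (m + 1)) 0)) := by module
    rw [hrec', hrec, hM]
    generalize ((N : ℂ) + lam) • 1 - Jdiag N = Y at *
    generalize Jdiag N * (Amat N (μch N a))ᴴ = X at *
    generalize (lam : ℂ) • 1 + Jdiag N + X = Q at *
    generalize Jdiag N - ((N : ℂ) + 1 + lam) • 1 = D at *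
    generalize 1 + Acal N a (m + 1 + lam) = G at *
    generalize (Lmat N a (μch N a) 0)⁻¹ * (1 + Amat N (μch N a)) ^ (m + 1 + lam) = S at *
    generalize ((1 + Amat N (μch N a)) ^ lam)⁻¹ = Ei at *
    generalize ((1 + Amat N (μch N a)) ^ (lam + 1))⁻¹ = Ei' at *
    generalize (1 + Amat N (μch N a)) ^ (lam + 1) = E' at *
    generalize Lmat N a (μch N a) 0 = L at *
    have hl : S * G ^ m * Ei' * L * (E' * Q * Ei) = S * (G ^ m * (Y + 1 + X)) * Ei * L := by
      calc S * G ^ m * Ei' * L * (E' * Q * Ei) = S * G ^ m * Ei' * (L * E') * Q * Ei := by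
            simp only [mul_assoc]
        _ = S * G ^ m * (Ei' * E') * (L * Q) * Ei := by rw [hEL']; simp only [mul_assoc]
        _ = S * G ^ m * (Y + 1 + X) * (L * Ei) := by
            rw [h2, hLX', mul_one]; simp only [mul_assoc]
        _ = _ := by rw [hELi]; simp only [mul_assoc]
    have hr : K * (S * G ^ (m + 1) * Ei * L) = -(S * (G ^ m * (Y + 1 + X)) * Ei * L) := by
      rw [hpow, ← mul_assoc, ← mul_assoc, ← mul_assoc, hconj, hD]
      noncomm_ring
    rw [mul_smul_comm, mul_smul_comm, smul_mul_assoc, hl, hr]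
    module

end Solution

/-- the value at zero of the monic matrix Charlier polynomials:
`P_n^{(λ)}(0) = (-a)^n L₀⁻¹ (I+A)^{n+λ} (I+𝒜_{n+λ})^n (I+A)^{-λ} L₀`. -/
theorem charlier_value_at_zero (N : ℕ) (hN : 1 ≤ N) (a : ℝ) (ha : 0 < a)
    (P : ℕ → ℕ → Polynomial (Mat N))
    (hP : ∀ lam : ℕ, IsMOSN (Wch N a (μch N a) (δch a lam) lam) (P lam)) :
    ∀ lam : ℕ, ∀ n : ℕ, 1 ≤ n →
      matEval (P lam n) 0
        = (-(a : ℂ)) ^ n • ((Lmat N a (μch N a) 0)⁻¹ * (1 + Amat N (μch N a)) ^ (n + lam)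
            * (1 + Acal N a (n + lam)) ^ n * ((1 + Amat N (μch N a)) ^ lam)⁻¹
            * Lmat N a (μch N a) 0) := by
  exact fun lam n _ => charlier_value_at_zero_of_monic_orthogonal ha hP n lam
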